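/- arXiv:1012.3030 — 3 statements merged into one kernel-verified Lean document; each statement's English description precedes it below -/
import Mathlib

section
/- Let n, m ∈ ℕ and let a 1-in-3 SAT instance be given by clauses C : Fin m → ((Fin n × Bool) × (Fin n × Bool) × (Fin n × Bool)), where for each j the three literals of clause j are x_j = (C j).1, y_j = (C j).2.1, z_j = (C j).2.2. Then the instance has a 1-in-3 solution if and only if there exists k : Fin n × Bool → ℤ such that: (i) for every u : Fin n, k (u, true) + k (u, false) = 1; (ii) for every j : Fin m, k x_j + k y_j + k z_j = 1; and (iii) Σ_{v : Fin n × Bool} |k v| + 5 · Σ_{j : Fin m} (|k x_j| + |k y_j| + |k z_j|) ≤ n + 5m. -/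
/-- Integer weights on literals whose two weights on each variable add up to one and have
total absolute value at most the number of variables are the indicator of an assignment. -/
theorem exists_assignment_of_sum_abs_le {n : ℕ} (k : Fin n × Bool → ℤ)
    (hk : ∀ u : Fin n, k (u, true) + k (u, false) = 1)
    (hsum : ∑ v : Fin n × Bool, |k v| ≤ n) :
    ∃ τ : Fin n → Bool, ∀ v : Fin n × Bool, k v = if τ v.1 = v.2 then 1 else 0 := by
  have hge : ∀ u ∈ Finset.univ, (1 : ℤ) ≤ |k (u, true)| + |k (u, false)| := fun u _ => by
    simpa [hk u] using abs_add_le (k (u, true)) (k (u, false))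
  have hle : ∑ u : Fin n, (|k (u, true)| + |k (u, false)|) ≤ n := by
    simpa [Fintype.sum_prod_type] using hsum
  have heq : ∑ _u : Fin n, (1 : ℤ) = ∑ u : Fin n, (|k (u, true)| + |k (u, false)|) :=
    le_antisymm (Finset.sum_le_sum hge) (by simpa using hle)
  have htight := (Finset.sum_eq_sum_iff_of_le hge).1 heq
  refine ⟨fun u => decide (k (u, true) = 1), ?_⟩
  rintro ⟨u, s⟩
  have h₁ := hk u
  have h₂ := htight u (Finset.mem_univ u)
  have h₃ : k (u, true) = 0 ∨ k (u, true) = 1 := by grind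
  rcases h₃ with h | h <;> cases s <;> simp [h] <;> omega

/-- The arithmetic core of the reduction of 1-in-3 SAT to the Optimal Bounding
Chain Problem: a 1-in-3 SAT instance with `n` variables and clauses
`C : Fin m → ((Fin n × Bool) × (Fin n × Bool) × (Fin n × Bool))` has a solution
in which every clause contains exactly one true literal iff there are integer
weights `k` on the literals satisfying the variable equations, the clause
equations, and the ℓ¹-norm bound `‖k‖₁ + 5·Σ_j (|k x_j| + |k y_j| + |k z_j|) ≤ n + 5m`. -/
theorem one_in_three_sat_iff_bounding_chain
    (n m : ℕ) (C : Fin m → ((Fin n × Bool) × (Fin n × Bool) × (Fin n × Bool))) :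
    (∃ τ : Fin n → Bool,
        ∀ j : Fin m,
          ((if τ (C j).1.1 = (C j).1.2 then (1 : ℤ) else 0) +
           (if τ (C j).2.1.1 = (C j).2.1.2 then (1 : ℤ) else 0) +
           (if τ (C j).2.2.1 = (C j).2.2.2 then (1 : ℤ) else 0)) = 1)
      ↔ (∃ k : Fin n × Bool → ℤ,
          (∀ u : Fin n, k (u, true) + k (u, false) = 1) ∧
          (∀ j : Fin m, k (C j).1 + k (C j).2.1 + k (C j).2.2 = 1) ∧
          (∑ v : Fin n × Bool, |k v|) +
            5 * (∑ j : Fin m, (|k (C j).1| + |k (C j).2.1| + |k (C j).2.2|))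
              ≤ (n : ℤ) + 5 * m) := by
  constructor
  · rintro ⟨τ, hτ⟩
    have habs : ∀ v : Fin n × Bool,
        |if τ v.1 = v.2 then (1 : ℤ) else 0| = if τ v.1 = v.2 then 1 else 0 := fun v =>
      abs_of_nonneg (by split_ifs <;> simp)
    have hvar : ∀ u : Fin n,
        (if τ u = true then (1 : ℤ) else 0) + (if τ u = false then 1 else 0) = 1 := fun u => by
      cases τ u <;> simp
    refine ⟨fun v => if τ v.1 = v.2 then 1 else 0, hvar, hτ, le_of_eq ?_⟩
    simp only [habs, hτ, Fintype.sum_prod_type, Fintype.sum_bool, hvar]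
    simp
  · rintro ⟨k, hvar, hclause, hnorm⟩
    have hge : (m : ℤ) ≤ ∑ j : Fin m, (|k (C j).1| + |k (C j).2.1| + |k (C j).2.2|) := by
      calc (m : ℤ) = ∑ _j : Fin m, (1 : ℤ) := by simp
        _ ≤ _ := Finset.sum_le_sum fun j _ => by
          simpa [hclause j] using abs_add_three (k (C j).1) (k (C j).2.1) (k (C j).2.2)
    obtain ⟨τ, hτ⟩ := exists_assignment_of_sum_abs_le k hvar (by linarith)
    exact ⟨τ, fun j => by simpa only [hτ] using hclause j⟩
end

section
/- Let V be a finite type, let L and R be disjoint finite subsets of V, and let c : V → V → ℤ be a 1-chain, i.e. c u v = -c v u for all u, v. Suppose the divergence div c v = Σ_u c u v vanishes for every v ∉ L ∪ R, and Σ_{v ∈ R} div c v = 1. Then there exist k ∈ ℕ and vertices p : Fin (k+1) → V with p 0 ∈ L, p k ∈ R, and c (p i) (p (i+1)) > 0 for every i < k; that is, the positive support of c contains a directed path from L to R. -/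
theorem Relation.ReflTransGen.exists_fin_path {V : Type*} {r : V → V → Prop} {a b : V}
    (h : Relation.ReflTransGen r a b) :
    ∃ (k : ℕ) (p : Fin (k + 1) → V),
      p 0 = a ∧ p (Fin.last k) = b ∧ ∀ i : Fin k, r (p i.castSucc) (p i.succ) := by
  induction h using Relation.ReflTransGen.head_induction_on with
  | refl => exact ⟨0, fun _ => b, rfl, rfl, fun i => i.elim0⟩
  | @head a d had _ ih =>
    obtain ⟨k, p, h0, hk, hp⟩ := ih
    refine ⟨k + 1, Fin.cons a p, rfl, by simpa [← Fin.succ_last] using hk, fun i => ?_⟩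
    cases i using Fin.cases with
    | zero => simpa [h0] using had
    | succ i => simpa [← Fin.succ_castSucc] using hp i

theorem Finset.sum_sum_eq_zero_of_antisymm {V : Type*} (S : Finset V) (c : V → V → ℤ)
    (hanti : ∀ u v : V, c u v = -c v u) : ∑ v ∈ S, ∑ u ∈ S, c u v = 0 := by
  have h : ∑ v ∈ S, ∑ u ∈ S, c u v = -∑ v ∈ S, ∑ u ∈ S, c u v := by
    conv_lhs => rw [Finset.sum_comm]
    simp only [← Finset.sum_neg_distrib, ← hanti]
  lia

/-- A set closed under predecessors along positive arcs has nonpositive total divergence. -/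
theorem Finset.sum_div_nonpos_of_closed {V : Type*} [Fintype V] [DecidableEq V]
    (S : Finset V) (c : V → V → ℤ) (hanti : ∀ u v : V, c u v = -c v u)
    (hS : ∀ u v : V, v ∈ S → 0 < c u v → u ∈ S) : ∑ v ∈ S, ∑ u : V, c u v ≤ 0 := by
  simp only [← Finset.sum_add_sum_compl S, Finset.sum_add_distrib,
    S.sum_sum_eq_zero_of_antisymm c hanti, zero_add]
  refine Finset.sum_nonpos fun v hv => Finset.sum_nonpos fun u hu => ?_
  by_contra! h
  exact Finset.mem_compl.1 hu (hS u v hv h)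


/-- Desingularization in the toy problem: if a 1-chain `c` on a finite vertex set
has zero divergence away from `L ∪ R` and total divergence `1` into `R`, then the
positive support of `c` contains a directed path from `L` to `R`. -/
theorem exists_path_of_div
    {V : Type*} [Fintype V] [DecidableEq V]
    (L R : Finset V) (hLR : Disjoint L R)
    (c : V → V → ℤ) (hanti : ∀ u v : V, c u v = -c v u)
    (hdiv : ∀ v : V, v ∉ L ∪ R → (∑ u : V, c u v) = 0)
    (hR : (∑ v ∈ R, ∑ u : V, c u v) = 1) :
    ∃ (k : ℕ) (p : Fin (k + 1) → V),
      p 0 ∈ L ∧ p (Fin.last k) ∈ R ∧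
      ∀ i : Fin k, 0 < c (p i.castSucc) (p i.succ) := by
  classical
  let S : Finset V := {v | ∃ w ∈ R, Relation.ReflTransGen (fun u v => 0 < c u v) v w}
  have hclosed : ∑ v ∈ S, ∑ u : V, c u v ≤ 0 := by
    refine S.sum_div_nonpos_of_closed c hanti fun u v hv huv => ?_
    obtain ⟨w, hw, hvw⟩ := (Finset.mem_filter.1 hv).2
    exact Finset.mem_filter.2 ⟨Finset.mem_univ u, w, hw, hvw.head huv⟩
  have hRS : R ⊆ S := fun v hv => Finset.mem_filter.2 ⟨Finset.mem_univ v, v, hv, .refl⟩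
  obtain ⟨v, hvS, hvL⟩ : ∃ v ∈ S, v ∈ L := by
    by_contra! hSL
    have hsum : ∑ v ∈ R, ∑ u : V, c u v = ∑ v ∈ S, ∑ u : V, c u v :=
      Finset.sum_subset hRS fun v hvS hvR => hdiv v (by simp [hSL v hvS, hvR])
    lia
  obtain ⟨w, hw, hvw⟩ := (Finset.mem_filter.1 hvS).2
  obtain ⟨k, p, h0, hk, hp⟩ := hvw.exists_fin_path
  exact ⟨k, p, h0 ▸ hvL, hk ▸ hw, hp⟩
end

section
/- Let V be a finite type, let L and R be disjoint finite subsets of V, and let w : V → V → ℝ satisfy w u v = w v u > 0 for all u ≠ v. For a 1-chain c : V → V → ℤ (c u v = -c v u) define N(c) = (1/2) Σ_{u, v} w u v · |c u v|. Say c is feasible if div c v = Σ_u c u v vanishes for all v ∉ L ∪ R and Σ_{v ∈ R} div c v = 1. Suppose c is feasible and N(c) ≤ N(c') for every feasible 1-chain c'. Then there exist k ∈ ℕ and an injective map p : Fin (k+1) → V with p 0 ∈ L, p k ∈ R, such that for all u, v: c u v = 1 if (u, v) = (p i, p (i+1)) for some i < k, c u v = -1 if (v, u) = (p i, p (i+1))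 for some i < k, and c u v = 0 otherwise. In other words, a minimum-weight feasible 1-chain is exactly the signed indicator chain of an embedded path from L to R. -/
/-- If a positive net amount of the antisymmetric chain `c` flows into `T`, then some edge entering
`T` carries a positive coefficient. -/
theorem exists_pos_edge_into_of_sum_pos {V : Type*} [Fintype V] [DecidableEq V]
    (c : V → V → ℤ) (hanti : ∀ u v : V, c u v = -c v u) (T : Finset V)
    (hT : 0 < ∑ v ∈ T, ∑ u : V, c u v) : ∃ u ∉ T, ∃ v ∈ T, 0 < c u v := by
  by_contra! h
  have hself : ∑ v ∈ T, ∑ u ∈ T, c u v = 0 := by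
    have hneg : ∑ v ∈ T, ∑ u ∈ T, c u v = -∑ v ∈ T, ∑ u ∈ T, c u v := by
      conv_lhs => rw [Finset.sum_comm]
      simp only [← Finset.sum_neg_distrib]
      exact Finset.sum_congr rfl fun u _ => Finset.sum_congr rfl fun v _ => hanti u v
    omega
  have hout : ∑ v ∈ T, ∑ u ∈ Tᶜ, c u v ≤ 0 :=
    Finset.sum_nonpos fun v hv => Finset.sum_nonpos fun u hu => h u (by simpa using hu) v hv
  have hsplit : ∑ v ∈ T, ∑ u : V, c u v = ∑ v ∈ T, ∑ u ∈ T, c u v + ∑ v ∈ T, ∑ u ∈ Tᶜ, c u v := by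
    rw [← Finset.sum_add_distrib]
    exact Finset.sum_congr rfl fun v _ => (Finset.sum_add_sum_compl T _).symm
  omega

/-- `v` is the endpoint of an embedded path starting in `L` all of whose steps satisfy `r`. -/
def EmbeddedReachable {V : Type*} (r : V → V → Prop) (L : Finset V) (v : V) : Prop :=
  ∃ (k : ℕ) (p : Fin (k + 1) → V), Function.Injective p ∧ p 0 ∈ L ∧ p (Fin.last k) = v ∧
    ∀ i : Fin k, r (p i.castSucc) (p i.succ)

theorem EmbeddedReachable.of_mem {V : Type*} (r : V → V → Prop) {L : Finset V} {v : V}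
    (hv : v ∈ L) : EmbeddedReachable r L v :=
  ⟨0, fun _ => v, fun i j _ => Subsingleton.elim (α := Fin 1) i j, hv, rfl, fun i => i.elim0⟩

theorem EmbeddedReachable.step {V : Type*} {r : V → V → Prop} {L : Finset V} {u v : V}
    (hu : EmbeddedReachable r L u) (huv : r u v) : EmbeddedReachable r L v := by
  obtain ⟨k, p, hinj, h0, hlast, hstep⟩ := hu
  by_cases hv : v ∈ Set.range p
  · obtain ⟨j, rfl⟩ := hv
    refine ⟨j, fun i => p (Fin.castLE (by omega) i), ?_, h0, rfl, fun i => ?_⟩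
    · exact hinj.comp (Fin.castLE_injective _)
    · exact hstep (Fin.castLE (by omega) i)
  · refine ⟨k + 1, Fin.snoc p v, Fin.snoc_injective_iff.2 ⟨hinj, hv⟩, ?_, by simp, fun i => ?_⟩
    · rw [← Fin.castSucc_zero, Fin.snoc_castSucc]
      exact h0
    · induction i using Fin.lastCases with
      | last => simpa [hlast] using huv
      | cast i =>
        rw [Fin.snoc_castSucc, Fin.succ_castSucc, Fin.snoc_castSucc]
        exact hstep i

/-- The number of times the path `p` traverses the directed edge from `u` to `v`. -/
def pathEdgeCount {V : Type*} [DecidableEq V] {k : ℕ} (p : Fin (k + 1) → V) (u v : V) : ℤ :=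
  ∑ i : Fin k, if u = p i.castSucc ∧ v = p i.succ then 1 else 0

theorem pathEdgeCount_eq_one {V : Type*} [DecidableEq V] {k : ℕ} {p : Fin (k + 1) → V}
    (hp : Function.Injective p) {u v : V} (h : ∃ i : Fin k, u = p i.castSucc ∧ v = p i.succ) :
    pathEdgeCount p u v = 1 := by
  obtain ⟨i, rfl, rfl⟩ := h
  rw [pathEdgeCount, Finset.sum_eq_single i]
  · simp
  · intro j _ hj
    exact if_neg fun h => hj (Fin.castSucc_injective k (hp h.1)).symm
  · simp

theorem pathEdgeCount_eq_zero {V : Type*} [DecidableEq V] {k : ℕ} {p : Fin (k + 1) → V}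
    {u v : V} (h : ¬ ∃ i : Fin k, u = p i.castSucc ∧ v = p i.succ) :
    pathEdgeCount p u v = 0 :=
  Finset.sum_eq_zero fun i _ => if_neg fun hi => h ⟨i, hi⟩

/-- The signed indicator chain of a path. -/
def pathChain {V : Type*} [DecidableEq V] {k : ℕ} (p : Fin (k + 1) → V) (u v : V) : ℤ :=
  pathEdgeCount p u v - pathEdgeCount p v u

theorem sum_pathChain {V : Type*} [Fintype V] [DecidableEq V] {k : ℕ} (p : Fin (k + 1) → V)
    (v : V) : ∑ u : V, pathChain p u v =
      (if v = p (Fin.last k) then 1 else 0) - (if v = p 0 then 1 else 0) := by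
  have hin : ∑ u : V, pathEdgeCount p u v = ∑ i : Fin k, if v = p i.succ then 1 else 0 := by
    simp only [pathEdgeCount]
    rw [Finset.sum_comm]
    simp [ite_and]
  have hout : ∑ u : V, pathEdgeCount p v u = ∑ i : Fin k, if v = p i.castSucc then 1 else 0 := by
    simp only [pathEdgeCount]
    rw [Finset.sum_comm]
    simp [ite_and]
  have htel := (Fin.sum_univ_succ fun i => if v = p i then (1 : ℤ) else 0).symm.trans
    (Fin.sum_univ_castSucc fun i => if v = p i then (1 : ℤ) else 0)
  simp only [pathChain, Finset.sum_sub_distrib, hin, hout]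
  linarith

/-- Toy problem: a minimum-weight feasible 1-chain joining `L` to `R` is exactly
the signed indicator chain of an embedded path from `L` to `R`. -/
theorem min_feasible_chain_is_embedded_path
    {V : Type*} [Fintype V] [DecidableEq V]
    (L R : Finset V) (hLR : Disjoint L R)
    (w : V → V → ℝ) (hwsymm : ∀ u v : V, w u v = w v u)
    (hwpos : ∀ u v : V, u ≠ v → 0 < w u v)
    (c : V → V → ℤ) (hanti : ∀ u v : V, c u v = -c v u)
    (hdiv : ∀ v : V, v ∉ L ∪ R → (∑ u : V, c u v) = 0)
    (hR : (∑ v ∈ R, ∑ u : V, c u v) = 1)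
    (hmin : ∀ c' : V → V → ℤ,
      (∀ u v : V, c' u v = -c' v u) →
      (∀ v : V, v ∉ L ∪ R → (∑ u : V, c' u v) = 0) →
      (∑ v ∈ R, ∑ u : V, c' u v) = 1 →
      (1 / 2 : ℝ) * ∑ u : V, ∑ v : V, w u v * |(c u v : ℝ)|
        ≤ (1 / 2 : ℝ) * ∑ u : V, ∑ v : V, w u v * |(c' u v : ℝ)|) :
    ∃ (k : ℕ) (p : Fin (k + 1) → V),
      Function.Injective p ∧ p 0 ∈ L ∧ p (Fin.last k) ∈ R ∧
      ∀ u v : V,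
        ((∃ i : Fin k, u = p i.castSucc ∧ v = p i.succ) → c u v = 1) ∧
        ((∃ i : Fin k, v = p i.castSucc ∧ u = p i.succ) → c u v = -1) ∧
        ((¬ (∃ i : Fin k, u = p i.castSucc ∧ v = p i.succ) ∧
          ¬ (∃ i : Fin k, v = p i.castSucc ∧ u = p i.succ)) → c u v = 0) := by
  have hdiag (u : V) : c u u = 0 := by
    have := hanti u u
    omega
  obtain ⟨t, htR, k, p, hp, h0, rfl, hpos⟩ :
      ∃ t ∈ R, EmbeddedReachable (fun u v => 0 < c u v) L t := by
    by_contra! hunreach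
    classical
    let T : Finset V := {v | ¬ EmbeddedReachable (fun u v => 0 < c u v) L v}
    have hRT : R ⊆ T := fun v hv => by simpa [T] using hunreach v hv
    have hsum : ∑ v ∈ R, ∑ u : V, c u v = ∑ v ∈ T, ∑ u : V, c u v := by
      refine Finset.sum_subset hRT fun v hvT hvR => hdiv v fun hv => ?_
      rcases Finset.mem_union.1 hv with hv | hv
      · exact (Finset.mem_filter.1 hvT).2 (.of_mem _ hv)
      · exact hvR hv
    obtain ⟨u, hu, v, hv, huv⟩ := exists_pos_edge_into_of_sum_pos c hanti T (by omega)
    simp only [T, Finset.mem_filter, Finset.mem_univ, true_and, not_not] at hu hv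
    exact hv (hu.step huv)
  have hforward {u v : V} (h : ∃ i : Fin k, u = p i.castSucc ∧ v = p i.succ) : 0 < c u v := by
    obtain ⟨i, rfl, rfl⟩ := h
    exact hpos i
  have hchain_forward {u v : V} (h : ∃ i : Fin k, u = p i.castSucc ∧ v = p i.succ) :
      pathChain p u v = 1 := by
    have hnot : ¬ ∃ i : Fin k, v = p i.castSucc ∧ u = p i.succ := fun h' => by
      linarith [hforward h, hforward h', hanti u v]
    simp [pathChain, pathEdgeCount_eq_one hp h, pathEdgeCount_eq_zero hnot]
  have hchain_anti (u v : V) : pathChain p u v = -pathChain p v u := by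
    simp [pathChain]
  have hchain_zero {u v : V} (h : ¬ ∃ i : Fin k, u = p i.castSucc ∧ v = p i.succ)
      (h' : ¬ ∃ i : Fin k, v = p i.castSucc ∧ u = p i.succ) : pathChain p u v = 0 := by
    simp [pathChain, pathEdgeCount_eq_zero h, pathEdgeCount_eq_zero h']
  have habs (u v : V) : |pathChain p u v| ≤ |c u v| := by
    by_cases h : ∃ i : Fin k, u = p i.castSucc ∧ v = p i.succ
    · rw [hchain_forward h, abs_one, abs_of_pos (hforward h)]
      exact hforward h
    by_cases h' : ∃ i : Fin k, v = p i.castSucc ∧ u = p i.succ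
    · rw [hchain_anti, hanti, abs_neg, abs_neg, hchain_forward h', abs_one,
        abs_of_pos (hforward h')]
      exact hforward h'
    · simp [hchain_zero h h']
  have h0R : p 0 ∉ R := Finset.disjoint_left.1 hLR h0
  have hle := hmin (pathChain p) hchain_anti
    (fun v hv => by
      rw [Finset.mem_union, not_or] at hv
      rw [sum_pathChain, if_neg (ne_of_mem_of_not_mem htR hv.2).symm,
        if_neg (ne_of_mem_of_not_mem h0 hv.1).symm, sub_zero])
    (by simp [sum_pathChain, htR, h0R])
  have hterm (u v : V) : w u v * |(pathChain p u v : ℝ)| ≤ w u v * |(c u v : ℝ)| := by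
    rcases eq_or_ne u v with rfl | huv
    · simp [pathChain, hdiag]
    · exact mul_le_mul_of_nonneg_left (by exact_mod_cast habs u v) (hwpos u v huv).le
  have hrow (u : V) : ∑ v, w u v * |(pathChain p u v : ℝ)| ≤ ∑ v, w u v * |(c u v : ℝ)| :=
    Finset.sum_le_sum fun v _ => hterm u v
  have hsum : ∑ u, ∑ v, w u v * |(pathChain p u v : ℝ)| = ∑ u, ∑ v, w u v * |(c u v : ℝ)| :=
    le_antisymm (Finset.sum_le_sum fun u _ => hrow u) (by linarith)
  have heq (u v : V) : |pathChain p u v| = |c u v| := by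
    rcases eq_or_ne u v with rfl | huv
    · simp [pathChain, hdiag]
    have hu := (Finset.sum_eq_sum_iff_of_le fun u _ => hrow u).1 hsum u (Finset.mem_univ u)
    have hv := (Finset.sum_eq_sum_iff_of_le fun v _ => hterm u v).1 hu v (Finset.mem_univ v)
    exact_mod_cast mul_left_cancel₀ (hwpos u v huv).ne' hv
  have hone {u v : V} (h : ∃ i : Fin k, u = p i.castSucc ∧ v = p i.succ) : c u v = 1 := by
    rw [← abs_of_pos (hforward h), ← heq, hchain_forward h, abs_one]
  refine ⟨k, p, hp, h0, htR, fun u v => ⟨hone, fun h => ?_, fun h => ?_⟩⟩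
  · rw [hanti, hone h]
  · rw [← abs_eq_zero, ← heq, hchain_zero h.1 h.2, abs_zero]
end
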